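/- There exist a constant c > 0 and an integer n₀ such that for all n ≥ n₀, 3^{B(n)} ≥ n + c·log(log n). (Main theorem, first form: 3^{B(n)} ≥ n + Ω(log log n).) -/

import Mathlib

/-- A weighing matrix has all entries in `{-1, 0, 1}`. -/
def IsWeighing {k n : ℕ} (M : Matrix (Fin k) (Fin n) ℤ) : Prop :=
  ∀ i j, M i j = -1 ∨ M i j = 0 ∨ M i j = 1

/-- The vector of coin weights `(1, 2, …, n)`. -/
def coinVec (n : ℕ) : Fin n → ℤ := fun j => (j : ℤ) + 1

/-- The componentwise sign of `M · v` where `v = (1, …, n)`. -/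
def wvec {k n : ℕ} (M : Matrix (Fin k) (Fin n) ℤ) : Fin k → ℤ :=
  fun i => Int.sign (Matrix.mulVec M (coinVec n) i)

/-- `M` is Münchhausen: a weighing matrix such that for every permutation matrix `π`,
`w(M·π) = w(M)` implies `π = I`. -/
def IsMunchhausen {k n : ℕ} (M : Matrix (Fin k) (Fin n) ℤ) : Prop :=
  IsWeighing M ∧
    ∀ π : Equiv.Perm (Fin n), wvec (M * π.permMatrix ℤ) = wvec M → π = 1

/-- `M` with its rows permuted according to `σ`. -/
def rowPerm {k n : ℕ} (σ : Equiv.Perm (Fin k)) (M : Matrix (Fin k) (Fin n) ℤ) :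
    Matrix (Fin k) (Fin n) ℤ :=
  Matrix.submatrix M σ id

/-- The Baron's omni-sequence: the least `k` for which a `k × n` Münchhausen matrix exists. -/
noncomputable def B (n : ℕ) : ℕ :=
  sInf {k : ℕ | ∃ M : Matrix (Fin k) (Fin n) ℤ, IsMunchhausen M}

theorem wvec_mul_permMatrix {k n : ℕ} (M : Matrix (Fin k) (Fin n) ℤ)
    (π : Equiv.Perm (Fin n)) (i : Fin k) :
    wvec (M * π.permMatrix ℤ) i = Int.sign (∑ j, M i j * coinVec n (π j)) := by
  rw [wvec, ← Matrix.mulVec_mulVec, Matrix.permMatrix_mulVec]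
  rfl

/-- Comparing every pair of coins gives a Münchhausen matrix. -/
theorem exists_isMunchhausen (n : ℕ) :
    ∃ k : ℕ, ∃ M : Matrix (Fin k) (Fin n) ℤ, IsMunchhausen M := by
  let e := (finProdFinEquiv : Fin n × Fin n ≃ Fin (n * n)).symm
  let M : Matrix (Fin (n * n)) (Fin n) ℤ := fun i j =>
    (if j = (e i).1 then 1 else 0) - (if j = (e i).2 then 1 else 0)
  refine ⟨n * n, M, fun i j => ?_, fun π hπ => ?_⟩
  · dsimp only [M]
    split_ifs <;> simp
  · have key : ∀ (τ : Equiv.Perm (Fin n)) (a b : Fin n),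
        wvec (M * τ.permMatrix ℤ) (e.symm (a, b)) = Int.sign ((τ a : ℤ) - τ b) := by
      intro τ a b
      rw [wvec_mul_permMatrix]
      simp [M, coinVec, sub_mul, Finset.sum_sub_distrib]
    have hmono : StrictMono π := by
      intro a b hab
      have h := congrFun hπ (e.symm (b, a))
      have h1 := key 1 b a
      rw [Equiv.Perm.one_def, Matrix.permMatrix_refl, Matrix.mul_one] at h1
      rw [key, h1, Int.sign_eq_one_of_pos (a := ((Equiv.refl _ b : Fin n) : ℤ) - _)
        (by simpa using hab), Int.sign_eq_one_iff_pos] at h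
      simpa using h
    have h := (StrictMono.range_inj hmono (strictMono_id (α := Fin n))).1
      (by simp [π.surjective.range_eq])
    ext1 a
    exact congrFun h a

theorem IsMunchhausen.column_injective {k n : ℕ} {M : Matrix (Fin k) (Fin n) ℤ}
    (hM : IsMunchhausen M) : Function.Injective fun j i => M i j := by
  intro a b hab
  by_contra hne
  refine hne (Equiv.swap_eq_refl_iff.1 (hM.2 (Equiv.swap a b) ?_))
  funext i
  rw [wvec_mul_permMatrix, wvec, Matrix.mulVec, dotProduct,
    ← Equiv.sum_comp (Equiv.swap a b) (fun j => M i j * coinVec n j)]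
  congr 1
  refine Finset.sum_congr rfl fun j _ => ?_
  have hi : M i a = M i b := congrFun hab i
  congr 1
  rcases eq_or_ne j a with rfl | hja
  · simp [hi]
  rcases eq_or_ne j b with rfl | hjb
  · simp [hi]
  rw [Equiv.swap_apply_of_ne_of_ne hja hjb]

/-- A nontrivial row symmetry preserving the signs and the set of columns is impossible. -/
theorem IsMunchhausen.eq_one_of_row_symmetry {k n : ℕ} {M : Matrix (Fin k) (Fin n) ℤ}
    (hM : IsMunchhausen M) (σ : Equiv.Perm (Fin k)) (hσ : ∀ i, wvec M (σ i) = wvec M i)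
    (π : Fin n → Fin n) (hπ : ∀ i j, M i (π j) = M (σ i) j) (j : Fin n) : π j = j := by
  have hinj : Function.Injective π := by
    intro a b hab
    refine hM.column_injective (funext fun i => ?_)
    have ha := hπ (σ.symm i) a
    have hb := hπ (σ.symm i) b
    rw [Equiv.apply_symm_apply] at ha hb
    exact ha.symm.trans ((congrArg _ hab).trans hb)
  let τ : Equiv.Perm (Fin n) := Equiv.ofBijective π (Finite.injective_iff_bijective.1 hinj)
  have h : τ = 1 := by
    refine hM.2 τ (funext fun i => ?_)
    obtain ⟨i, rfl⟩ := σ.surjective i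
    rw [wvec_mul_permMatrix, hσ, wvec, Matrix.mulVec, dotProduct,
      ← Equiv.sum_comp τ (fun j => M i j * coinVec n j)]
    congr 1
    exact Finset.sum_congr rfl fun j _ => by rw [← hπ]; rfl
  exact congrArg (fun ρ : Equiv.Perm (Fin n) => ρ j) h

theorem IsMunchhausen.le_three_pow {k n : ℕ} {M : Matrix (Fin k) (Fin n) ℤ}
    (hM : IsMunchhausen M) : n ≤ 3 ^ k ∧ k ≤ 3 ^ (3 ^ k - n + 1) := by
  classical
  let V : Finset ℤ := {-1, 0, 1}
  have hV : V.card = 3 := rfl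
  let T : Finset (Fin k → ℤ) := Fintype.piFinset fun _ => V
  let S : Finset (Fin k → ℤ) := Finset.univ.image fun j i => M i j
  have hT : T.card = 3 ^ k := by simp [T, hV]
  have hS : S.card = n := by
    simp [S, Finset.card_image_of_injective _ hM.column_injective]
  have hST : S ⊆ T := by
    intro x hx
    obtain ⟨j, -, rfl⟩ := Finset.mem_image.1 hx
    exact Fintype.mem_piFinset.2 fun i => by simpa [V] using hM.1 i j
  have hD : (T \ S).card = 3 ^ k - n := by rw [Finset.card_sdiff_of_subset hST, hT, hS]
  refine ⟨hS ▸ hT ▸ Finset.card_le_card hST, ?_⟩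
  by_contra! hk
  let F : Finset (ℤ × (↥(T \ S) → ℤ)) := V ×ˢ Fintype.piFinset fun _ => V
  have hF : F.card = 3 ^ (3 ^ k - n + 1) := by
    rw [Finset.card_product, Fintype.card_piFinset, Finset.prod_const, Finset.card_univ,
      Fintype.card_coe, hD, hV, pow_succ']
  obtain ⟨a, -, b, -, hab, heq⟩ := Finset.exists_ne_map_eq_of_card_lt_of_maps_to
    (s := (Finset.univ : Finset (Fin k))) (t := F)
    (f := fun i => (wvec M i, fun x : ↥(T \ S) => x.1 i)) (by simpa [hF] using hk) (by
      intro i _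
      refine Finset.mem_coe.2 (Finset.mem_product.2 ⟨?_, Fintype.mem_piFinset.2 fun x => ?_⟩)
      · rcases lt_trichotomy (Matrix.mulVec M (coinVec n) i) 0 with h | h | h
        · simp [V, wvec, Int.sign_eq_neg_one_of_neg h]
        · simp [V, wvec, h]
        · simp [V, wvec, Int.sign_eq_one_of_pos h]
      · exact Fintype.mem_piFinset.1 (Finset.mem_sdiff.1 x.2).1 i)
  obtain ⟨hw, hx⟩ := Prod.mk.inj heq
  have hfix : ∀ x ∈ T, x ∉ S → x a = x b := fun x hxT hxS =>
    congrFun hx ⟨x, Finset.mem_sdiff.2 ⟨hxT, hxS⟩⟩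
  have hswap : ∀ (α : Type) (x : Fin k → α), x a = x b → ∀ i, x (Equiv.swap a b i) = x i := by
    intro α x h i
    rcases eq_or_ne i a with rfl | hia
    · simp [h]
    rcases eq_or_ne i b with rfl | hib
    · simp [h]
    rw [Equiv.swap_apply_of_ne_of_ne hia hib]
  have hcol : ∀ j, ∃ j', ∀ i, M i j' = M (Equiv.swap a b i) j := by
    intro j
    have hjS : (fun i => M i j) ∈ S := Finset.mem_image_of_mem _ (Finset.mem_univ j)
    have hmem : (fun i => M (Equiv.swap a b i) j) ∈ S := by
      by_contra hnot
      have h := hfix _ (Fintype.mem_piFinset.2 fun i =>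
        Fintype.mem_piFinset.1 (hST hjS) (Equiv.swap a b i)) hnot
      simp only [Equiv.swap_apply_left, Equiv.swap_apply_right] at h
      refine hnot ?_
      rwa [funext (hswap ℤ (fun i => M i j) h.symm)]
    obtain ⟨j', -, h⟩ := Finset.mem_image.1 hmem
    exact ⟨j', congrFun h⟩
  choose π hπ using hcol
  have hsingle : (Pi.single a 1 : Fin k → ℤ) ∈ S := by
    by_contra hnot
    have h := hfix _ (Fintype.mem_piFinset.2 fun i => by
      rcases eq_or_ne i a with rfl | hia
      · simp [V]
      · simp [V, hia]) hnot
    simp [hab.symm] at h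
  obtain ⟨j, -, hj⟩ := Finset.mem_image.1 hsingle
  have h := hM.eq_one_of_row_symmetry (Equiv.swap a b) (hswap ℤ (wvec M) hw) π
    (fun i j => hπ j i) j
  have h1 := hπ j a
  have ha := congrFun hj a
  have hb := congrFun hj b
  simp only [Pi.single_eq_same, Pi.single_eq_of_ne hab.symm] at ha hb
  rw [h, Equiv.swap_apply_left, ha, hb] at h1
  exact one_ne_zero h1

/-- Main theorem, first form: `3 ^ B n ≥ n + Ω(log log n)`. -/
theorem main_theorem_first_form :
    ∃ c : ℝ, 0 < c ∧ ∃ n₀ : ℕ, ∀ n : ℕ, n₀ ≤ n →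
      (n : ℝ) + c * Real.log (Real.log n) ≤ (3 : ℝ) ^ B n := by
  refine ⟨1 / 6, by norm_num, 28, fun n hn => ?_⟩
  obtain ⟨M, hM⟩ := Nat.sInf_mem (exists_isMunchhausen n)
  change Matrix (Fin (B n)) (Fin n) ℤ at M
  obtain ⟨h1, h2⟩ := hM.le_three_pow
  change n ≤ 3 ^ B n at h1
  change B n ≤ 3 ^ (3 ^ B n - n + 1) at h2
  generalize B n = k at h1 h2
  obtain ⟨m, hm⟩ := Nat.exists_eq_add_of_le h1
  rw [hm, Nat.add_sub_cancel_left] at h2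
  have hk : 4 ≤ k := by
    by_contra! hlt
    have : 3 ^ k ≤ 3 ^ 3 := Nat.pow_le_pow_right (by norm_num) (by omega : k ≤ 3)
    omega
  have hm1 : 1 ≤ m := by
    by_contra! hlt
    obtain rfl : m = 0 := by omega
    omega
  have hn0 : (28 : ℝ) ≤ n := by exact_mod_cast hn
  have hlog3 : Real.log 3 ≤ 2 := by
    have := Real.log_le_sub_one_of_pos (show (0 : ℝ) < 3 by norm_num)
    linarith
  have hlogpos : 0 < Real.log n := Real.log_pos (by linarith)
  have hlog : Real.log n ≤ (3 : ℝ) ^ (3 * m) := calc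
    Real.log n ≤ Real.log ((3 : ℝ) ^ k) :=
      Real.log_le_log (by linarith) (by exact_mod_cast h1)
    _ = k * Real.log 3 := by rw [Real.log_pow]
    _ ≤ (3 : ℝ) ^ (m + 1) * 3 := by
      have : (k : ℝ) ≤ (3 : ℝ) ^ (m + 1) := by exact_mod_cast h2
      exact mul_le_mul this (by linarith) (Real.log_nonneg (by norm_num)) (by positivity)
    _ = (3 : ℝ) ^ (m + 2) := by ring
    _ ≤ (3 : ℝ) ^ (3 * m) := pow_le_pow_right₀ (by norm_num) (by omega)
  have hloglog : Real.log (Real.log n) ≤ 6 * m := calc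
    Real.log (Real.log n) ≤ Real.log ((3 : ℝ) ^ (3 * m)) := Real.log_le_log hlogpos hlog
    _ = 3 * m * Real.log 3 := by rw [Real.log_pow]; push_cast; ring
    _ ≤ 3 * m * 2 := by gcongr
    _ = 6 * m := by ring
  have hpow : (3 : ℝ) ^ k = n + m := by exact_mod_cast hm
  rw [hpow]
  linarith
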